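/- arXiv:2006.10372 — 2 statements merged into one kernel-verified Lean document; each statement's English description precedes it below -/
import Mathlib

section
/- Let V ∈ B(H) satisfy V P_k = P_k V for every k ∈ ℕ, and suppose V*V − 1 is a compact operator. Then there exists an invertible operator V' ∈ B(H) such that V − V' is compact; in other words, the image of V in the Calkin algebra B(H)/K is invertible. (In particular, every isometry in the Calkin-algebra image of the block-diagonal part of T is a unitary, so that algebra is a finite C*-algebra.) -/
noncomputable section

instance (α : Type*) [DecidableEq α] : DecidableEq (FreeMonoid α) :=
  fun a b => inferInstanceAs (Decidable (a.toList = b.toList))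

/-- The full Fock space of `ℂ^d`, modeled as `ℓ²` of the free monoid on `Fin d`. -/
abbrev FockSpace (d : ℕ) : Type := lp (fun _ : FreeMonoid (Fin d) => ℂ) 2

/-- The standard basis vector `e_α` of the Fock space. -/
noncomputable def fockBasis (d : ℕ) (α : FreeMonoid (Fin d)) : FockSpace d :=
  lp.single 2 α (1 : ℂ)

/-- `S_α = S_{α₁} ⋯ S_{αₙ}` for a word `α` (with `S_∅ = 1`). -/
noncomputable def wordOp {d : ℕ} (S : Fin d → (FockSpace d →L[ℂ] FockSpace d))
    (α : FreeMonoid (Fin d)) : FockSpace d →L[ℂ] FockSpace d :=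
  (α.toList.map S).prod

open Filter Topology Submodule in
/-- If orthogonal projections increase to the identity, they approximate a compact
operator in norm from the left. -/
theorem IsCompactOperator.eventually_norm_starProjection_orthogonal_comp_le {𝕜 E F : Type*}
    [RCLike 𝕜] [NormedAddCommGroup E] [NormedSpace 𝕜 E] [NormedAddCommGroup F]
    [InnerProductSpace 𝕜 F] {T : E →L[𝕜] F} (hT : IsCompactOperator ⇑T)
    (U : ℕ → Submodule 𝕜 F) [∀ n, (U n).HasOrthogonalProjection] (hU : Monotone U)
    (hU' : ⊤ ≤ (⨆ n, U n).topologicalClosure) {ε : ℝ} (hε : 0 < ε) :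
    ∀ᶠ n in atTop, ‖(U n)ᗮ.starProjection ∘L T‖ ≤ ε := by
  have htb : TotallyBounded (T '' Metric.closedBall 0 1) :=
    (IsCompactOperator.isCompact_closure_image_closedBall (f := (T : E →ₗ[𝕜] F)) hT
      1).totallyBounded.subset subset_closure
  obtain ⟨t, ht, hcover⟩ := Metric.totallyBounded_iff.1 htb (ε / 2) (half_pos hε)
  have hev : ∀ᶠ n in atTop, ∀ y ∈ t, ‖(U n)ᗮ.starProjection y‖ < ε / 2 := by
    rw [eventually_all_finite ht]
    intro y _
    have h := (tendsto_iff_norm_sub_tendsto_zero.1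
      (starProjection_tendsto_self U hU y hU')).eventually_lt_const (half_pos hε)
    filter_upwards [h] with n hn
    rwa [starProjection_orthogonal_val, norm_sub_rev]
  filter_upwards [hev] with n hn
  refine ContinuousLinearMap.opNorm_le_of_unit_norm hε.le fun x hx => ?_
  obtain ⟨y, hy, hxy⟩ := Set.mem_iUnion₂.1 (hcover ⟨x, by simp [hx], rfl⟩)
  rw [Metric.mem_ball, dist_eq_norm] at hxy
  calc ‖(U n)ᗮ.starProjection (T x)‖
      = ‖(U n)ᗮ.starProjection (T x - y) + (U n)ᗮ.starProjection y‖ := by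
        rw [← map_add, sub_add_cancel]
    _ ≤ ‖T x - y‖ + ‖(U n)ᗮ.starProjection y‖ :=
        (norm_add_le _ _).trans (by gcongr; exact norm_starProjection_apply_le _ _)
    _ ≤ ε := by linarith [hn y hy]

theorem Submodule.isCompactOperator_starProjection {𝕜 E : Type*} [RCLike 𝕜]
    [NormedAddCommGroup E] [InnerProductSpace 𝕜 E] (U : Submodule 𝕜 E) [FiniteDimensional 𝕜 U] :
    IsCompactOperator ⇑U.starProjection :=
  have : ProperSpace U := FiniteDimensional.proper_rclike 𝕜 U
  (isCompactOperator_of_locallyCompactSpace_dom U.orthogonalProjectionOnto).clm_comp U.subtypeL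

/-- An operator that is bounded below and leaves invariant finite-dimensional subspaces with dense
union is invertible. -/
theorem ContinuousLinearMap.isUnit_of_antilipschitz_of_mapsTo {𝕜 E : Type*} [RCLike 𝕜]
    [NormedAddCommGroup E] [NormedSpace 𝕜 E] [CompleteSpace E] {ι : Type*}
    (U : ι → Submodule 𝕜 E) [∀ i, FiniteDimensional 𝕜 (U i)]
    (hU : ⊤ ≤ (⨆ i, U i).topologicalClosure) {T : E →L[𝕜] E} {c : NNReal}
    (hT : AntilipschitzWith c T) (hTU : ∀ i, ∀ x ∈ U i, T x ∈ U i) : IsUnit T := by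
  rw [isUnit_iff_bijective, bijective_iff_dense_range_and_antilipschitz]
  refine ⟨top_unique (hU.trans (Submodule.topologicalClosure_mono (iSup_le fun i y hy => ?_))),
    c, hT⟩
  have hinj : Function.Injective ((T : E →ₗ[𝕜] E).restrict (hTU i)) := fun a b hab =>
    Subtype.ext (hT.injective (congrArg Subtype.val hab))
  obtain ⟨x, hx⟩ := LinearMap.injective_iff_surjective.1 hinj ⟨y, hy⟩
  exact ⟨x, congrArg Subtype.val hx⟩

open ContinuousLinearMap Submodule in
/-- A block-diagonal operator with finite-dimensional blocks which is an isometry modulo compact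
operators is a compact perturbation of an invertible operator. -/
theorem exists_isUnit_isCompactOperator_sub {𝕜 H : Type*} [RCLike 𝕜] [NormedAddCommGroup H]
    [InnerProductSpace 𝕜 H] [CompleteSpace H] (U : ℕ → Submodule 𝕜 H)
    [∀ n, FiniteDimensional 𝕜 (U n)] (hU : Monotone U)
    (hU' : ⊤ ≤ (⨆ n, U n).topologicalClosure) (V : H →L[𝕜] H)
    (hV : ∀ n, Commute V (U n).starProjection)
    (hc : IsCompactOperator ⇑(adjoint V * V - 1)) :
    ∃ V' : H →L[𝕜] H, IsUnit V' ∧ IsCompactOperator ⇑(V - V') := by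
  obtain ⟨N, hN⟩ := (hc.eventually_norm_starProjection_orthogonal_comp_le (T := adjoint V * V - 1)
    U hU hU' (ε := 1 / 2) (by norm_num)).exists
  set Q := (U N).starProjection with hQ
  set R := (U N)ᗮ.starProjection with hR
  have hR1 : R = 1 - Q := starProjection_orthogonal' _
  have hRR (x : H) : R (R x) = R x :=
    starProjection_eq_self_iff.2 (starProjection_apply_mem _ _)
  have hVR (x : H) : R (V x) = V (R x) := by
    have h : Commute V R := hR1 ▸ (Commute.one_right V).sub_right (hV N)
    exact (congrArg (fun T : H →L[𝕜] H => T x) h.eq).symm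
  have hQR (x : H) : Q (R x) = 0 := by
    rw [hQ, starProjection_apply_eq_zero_iff]
    exact starProjection_apply_mem _ _
  have hQV (x : H) : Q (V x) = V (Q x) :=
    (congrArg (fun T : H →L[𝕜] H => T x) (hV N).eq).symm
  have hRQ (x : H) : R (Q x) = 0 :=
    starProjection_orthogonal_apply_eq_zero (starProjection_apply_mem _ _)
  have hQQ (x : H) : Q (Q x) = Q x :=
    starProjection_eq_self_iff.2 (starProjection_apply_mem _ _)
  have hlower (x : H) : ‖R x‖ ^ 2 / 2 ≤ ‖V (R x)‖ ^ 2 := by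
    set A := adjoint V * V - 1 with hA
    have h1 : ‖V (R x)‖ ^ 2 = ‖R x‖ ^ 2 + RCLike.re (inner 𝕜 (A (R x)) (R x)) := by
      rw [hA]
      simp [inner_sub_left, adjoint_inner_left]
    have h2 : inner 𝕜 (A (R x)) (R x) = inner 𝕜 ((R ∘L A) (R x)) (R x) := by
      rw [comp_apply, hR, inner_starProjection_left_eq_right, ← hR, hRR]
    have h3 : ‖inner 𝕜 (A (R x)) (R x)‖ ≤ 1 / 2 * ‖R x‖ * ‖R x‖ := by
      rw [h2]
      refine (norm_inner_le_norm _ _).trans ?_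
      gcongr
      exact (R ∘L A).le_of_opNorm_le hN _
    have h4 := neg_le_of_abs_le (RCLike.abs_re_le_norm (inner 𝕜 (A (R x)) (R x)))
    nlinarith
  refine ⟨V * R + Q, ?_, ?_⟩
  · have hnorm (x : H) : ‖x‖ ≤ (2 : NNReal) * ‖(V * R + Q) x‖ := by
      have h1 := norm_sq_eq_add_norm_sq_starProjection x (U N)
      have h2 := norm_sq_eq_add_norm_sq_starProjection ((V * R + Q) x) (U N)
      simp only [← hQ, ← hR, add_apply, mul_apply_eq_comp, map_add, hQV, hVR, hQR, hRQ, hQQ, hRR,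
        map_zero, zero_add, add_zero] at h1 h2
      have h3 := hlower x
      refine le_of_sq_le_sq ?_ (by positivity)
      simp only [add_apply, mul_apply_eq_comp, mul_pow, h1, h2, NNReal.coe_ofNat]
      nlinarith [sq_nonneg ‖Q x‖, sq_nonneg ‖R x‖]
    have hsup : ⊤ ≤ (⨆ n, U (max n N)).topologicalClosure :=
      hU'.trans (topologicalClosure_mono (iSup_mono fun n => hU (le_max_left n N)))
    refine isUnit_of_antilipschitz_of_mapsTo (fun n => U (max n N)) hsup
      (antilipschitz_of_bound _ hnorm) fun n x hx => ?_
    have hQx : Q x ∈ U (max n N) := hU (le_max_right n N) (starProjection_apply_mem _ _)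
    have hVU (y : H) (hy : y ∈ U (max n N)) : V y ∈ U (max n N) := by
      rw [← starProjection_eq_self_iff] at hy ⊢
      have := congrArg (fun T : H →L[𝕜] H => T y) (hV (max n N)).eq
      simpa [hy, eq_comm] using this
    refine add_mem (hVU _ ?_) hQx
    rw [hR1]
    exact sub_mem hx hQx
  · have h : V - (V * R + Q) = (V - 1) * Q := by rw [hR1]; noncomm_ring
    rw [h]
    exact (U N).isCompactOperator_starProjection.clm_comp (V - 1)

theorem orthonormal_fockBasis (d : ℕ) : Orthonormal ℂ (fockBasis d) := by
  rw [orthonormal_iff_ite]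
  intro α β
  simp [fockBasis, lp.inner_single_left, Pi.single_apply]

theorem topologicalClosure_span_range_fockBasis (d : ℕ) :
    (Submodule.span ℂ (Set.range (fockBasis d))).topologicalClosure = ⊤ := by
  let b := HilbertBasis.ofRepr (LinearIsometryEquiv.refl ℂ (FockSpace d))
  have hb : fockBasis d = b := funext fun α => b.repr_symm_single α
  exact hb ▸ b.dense_span

open Submodule in
/-- The span of the basis vectors indexed by words of length less than `n`. -/
def fockTruncation (d n : ℕ) : Submodule ℂ (FockSpace d) :=
  span ℂ (fockBasis d '' {α | α.length < n})

theorem monotone_fockTruncation (d : ℕ) : Monotone (fockTruncation d) := fun _ _ h =>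
  Submodule.span_mono (Set.image_mono fun _ hα => lt_of_lt_of_le hα h)

instance (d n : ℕ) : FiniteDimensional ℂ (fockTruncation d n) :=
  FiniteDimensional.span_of_finite ℂ ((List.finite_length_lt (Fin d) n).image (fockBasis d))

theorem topologicalClosure_iSup_fockTruncation (d : ℕ) :
    (⨆ n, fockTruncation d n).topologicalClosure = ⊤ := by
  refine top_unique ((topologicalClosure_span_range_fockBasis d).ge.trans
    (Submodule.topologicalClosure_mono (Submodule.span_le.2 ?_)))
  rintro _ ⟨α, rfl⟩
  exact le_iSup (fockTruncation d) (α.length + 1)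
    (Submodule.subset_span ⟨α, Nat.lt_succ_self _, rfl⟩)

theorem starProjection_fockTruncation_fockBasis (d n : ℕ) (α : FreeMonoid (Fin d)) :
    (fockTruncation d n).starProjection (fockBasis d α) =
      if α.length < n then fockBasis d α else 0 := by
  split_ifs with h
  · exact Submodule.starProjection_eq_self_iff.2 (Submodule.subset_span ⟨α, h, rfl⟩)
  · rw [Submodule.starProjection_apply_eq_zero_iff, fockTruncation, Submodule.mem_orthogonal]
    intro u hu
    induction hu using Submodule.span_induction with
    | mem u hu =>
      obtain ⟨β, hβ, rfl⟩ := hu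
      exact (orthonormal_fockBasis d).inner_eq_zero fun hβα => h (hβα ▸ hβ)
    | zero => simp
    | add u v _ _ hu hv => rw [inner_add_left, hu, hv, add_zero]
    | smul c u _ hu => rw [inner_smul_left, hu, mul_zero]

/-- The projection onto words of length less than `n` is the sum of the projections onto the
homogeneous components. -/
theorem starProjection_fockTruncation_eq_sum {d : ℕ} {P : ℕ → (FockSpace d →L[ℂ] FockSpace d)}
    (hP : ∀ (k : ℕ) (α : FreeMonoid (Fin d)),
      P k (fockBasis d α) = if α.length = k then fockBasis d α else 0) (n : ℕ) :
    (fockTruncation d n).starProjection = ∑ k ∈ Finset.range n, P k := by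
  refine ContinuousLinearMap.ext_on (s := Set.range (fockBasis d)) ?_ ?_
  · rw [Submodule.dense_iff_topologicalClosure_eq_top]
    exact topologicalClosure_span_range_fockBasis d
  · rintro _ ⟨α, rfl⟩
    simp [starProjection_fockTruncation_fockBasis, hP]

open ContinuousLinearMap in
theorem statement5 (d : ℕ) (hd : 1 ≤ d)
    (P : ℕ → (FockSpace d →L[ℂ] FockSpace d))
    (hP : ∀ (k : ℕ) (α : FreeMonoid (Fin d)),
      P k (fockBasis d α) = if α.length = k then fockBasis d α else 0)
    (V : FockSpace d →L[ℂ] FockSpace d)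
    (hV : ∀ k : ℕ, V * P k = P k * V)
    (hc : IsCompactOperator ⇑(adjoint V * V - 1)) :
    ∃ V' : FockSpace d →L[ℂ] FockSpace d, IsUnit V' ∧ IsCompactOperator ⇑(V - V') := by
  refine exists_isUnit_isCompactOperator_sub (fockTruncation d) (monotone_fockTruncation d)
    (topologicalClosure_iSup_fockTruncation d).ge V (fun n => ?_) hc
  rw [starProjection_fockTruncation_eq_sum hP]
  exact Commute.sum_right _ _ _ fun k _ => hV k
end
end

section
/- Let Z be a weight operator and p ≥ 1. Then lim_{k→∞} ‖(Σ_{|α|=p} S_α Z S_α* − Z) P_{k+p}‖ = 0 (this is Condition A(p) for the weight sequence Z_k := Z restricted to the range of P_k, i.e. ‖I_p ⊗ Z_k − Z_{k+p}‖ → 0) if and only if S_α Z − Z S_α is compact for every word α of length p. Moreover, in this case S_α* Z − Z S_α* is also compact for every word α of length p. -/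
noncomputable section

open Filter Topology ContinuousLinearMap

section Operators

variable {E : Type*} [NormedAddCommGroup E] [InnerProductSpace ℂ E]

/-- A bounded sequence of operators converging strongly to zero on a set with dense span
converges strongly to zero. -/
theorem tendsto_apply_zero_of_dense_span {A : ℕ → E →L[ℂ] E} {C : ℝ} (hA : ∀ n, ‖A n‖ ≤ C)
    {s : Set E} (hs : Dense (Submodule.span ℂ s : Set E))
    (h : ∀ x ∈ s, Tendsto (fun n => A n x) atTop (𝓝 0)) (x : E) :
    Tendsto (fun n => A n x) atTop (𝓝 0) := by
  have hC : 0 ≤ C := (norm_nonneg _).trans (hA 0)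
  have hspan : ∀ y ∈ Submodule.span ℂ s, Tendsto (fun n => A n y) atTop (𝓝 0) := by
    intro y hy
    induction hy using Submodule.span_induction with
    | mem y hy => exact h y hy
    | zero => simp
    | add y z _ _ hy hz => simpa using hy.add hz
    | smul c y _ hy => simpa using hy.const_smul c
  rw [Metric.tendsto_atTop]
  intro ε hε
  obtain ⟨y, hy, hxy⟩ := hs.exists_dist_lt x (show 0 < ε / (2 * (C + 1)) by positivity)
  obtain ⟨N, hN⟩ := Metric.tendsto_atTop.1 (hspan y hy) (ε / 2) (by positivity)
  refine ⟨N, fun n hn => ?_⟩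
  have h1 := hN n hn
  rw [dist_zero_right] at h1 ⊢
  have h2 : ‖A n (x - y)‖ ≤ ε / 2 := by
    refine ((A n).le_of_opNorm_le (hA n) _).trans ?_
    rw [dist_eq_norm, lt_div_iff₀ (by positivity)] at hxy
    nlinarith [norm_nonneg (x - y)]
  calc ‖A n x‖ = ‖A n (x - y) + A n y‖ := by rw [← map_add, sub_add_cancel]
    _ ≤ ‖A n (x - y)‖ + ‖A n y‖ := norm_add_le _ _
    _ < ε := by linarith

/-- Composing a compact operator with contractions converging strongly to zero gives convergence
to zero in norm. -/
theorem IsCompactOperator.tendsto_norm_mul_zero {A : ℕ → E →L[ℂ] E} (hA : ∀ n, ‖A n‖ ≤ 1)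
    (h : ∀ x, Tendsto (fun n => A n x) atTop (𝓝 0)) {K : E →L[ℂ] E} (hK : IsCompactOperator K) :
    Tendsto (fun n => ‖A n * K‖) atTop (𝓝 0) := by
  obtain ⟨C, hC, hKC⟩ :=
    IsCompactOperator.image_closedBall_subset_compact (f := (K : E →ₗ[ℂ] E)) hK 1
  rw [Metric.tendsto_atTop]
  intro ε hε
  obtain ⟨t, htf, ht⟩ := Metric.totallyBounded_iff.1 hC.totallyBounded (ε / 4) (by positivity)
  have hev : ∀ᶠ n in atTop, ∀ y ∈ t, ‖A n y‖ < ε / 4 := by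
    rw [eventually_all_finite htf]
    intro y _
    have := (h y).norm
    rw [norm_zero] at this
    exact this.eventually_lt_const (by positivity)
  obtain ⟨N, hN⟩ := eventually_atTop.1 hev
  refine ⟨N, fun n hn => ?_⟩
  rw [dist_zero_right, norm_norm]
  refine lt_of_le_of_lt (opNorm_le_of_unit_norm (C := ε / 2) (by positivity) ?_) (by linarith)
  intro x hx
  have hx' : K x ∈ C := hKC ⟨x, by simp [hx], rfl⟩
  obtain ⟨y, hy, hxy⟩ := Set.mem_iUnion₂.1 (ht hx')
  rw [Metric.mem_ball, dist_eq_norm] at hxy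
  have h1 := (A n).le_of_opNorm_le (hA n) (K x - y)
  have h2 := hN n hn y hy
  calc ‖(A n * K) x‖ = ‖A n (K x - y) + A n y‖ := by rw [← map_add, sub_add_cancel]; rfl
    _ ≤ ‖A n (K x - y)‖ + ‖A n y‖ := norm_add_le _ _
    _ ≤ ε / 2 := by linarith

variable {P : ℕ → E →L[ℂ] E} (hmul : ∀ j k, P j * P k = if j = k then P k else 0)

include hmul in
theorem mul_sum_of_orthogonal (s : Finset ℕ) {k : ℕ} (hk : k ∈ s) : P k * ∑ j ∈ s, P j = P k := by
  rw [Finset.mul_sum, Finset.sum_eq_single_of_mem k hk, hmul, if_pos rfl]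
  intro j _ hj
  rw [hmul, if_neg hj.symm]

variable [CompleteSpace E] (hadj : ∀ k, adjoint (P k) = P k)

include hmul hadj in
theorem isStarProjection_sum_of_orthogonal (s : Finset ℕ) : IsStarProjection (∑ k ∈ s, P k) where
  isIdempotentElem := by
    rw [IsIdempotentElem, Finset.sum_mul]
    exact Finset.sum_congr rfl fun k hk => mul_sum_of_orthogonal hmul s hk
  isSelfAdjoint := by
    rw [IsSelfAdjoint, star_sum]
    exact Finset.sum_congr rfl fun k _ => hadj k

include hmul hadj in
theorem norm_sq_sum_apply_of_orthogonal (s : Finset ℕ) (x : E) :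
    ‖(∑ k ∈ s, P k) x‖ ^ 2 = ∑ k ∈ s, ‖P k x‖ ^ 2 := by
  have aux : ∀ Q : E →L[ℂ] E, IsStarProjection Q → ‖Q x‖ ^ 2 = RCLike.re (inner ℂ (Q x) x) := by
    intro Q hQ
    have h1 : adjoint Q = Q := hQ.isSelfAdjoint
    have h2 : Q (Q x) = Q x := DFunLike.congr_fun hQ.isIdempotentElem.eq x
    rw [← inner_self_eq_norm_sq (𝕜 := ℂ), ← adjoint_inner_left, h1, h2]
  rw [aux _ (isStarProjection_sum_of_orthogonal hmul hadj s), _root_.sum_apply, sum_inner, map_sum]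
  refine Finset.sum_congr rfl fun k _ => (aux _ ?_).symm
  simpa using isStarProjection_sum_of_orthogonal hmul hadj {k}

include hmul hadj in
/-- The norm of a block diagonal operator is controlled by the norms of its blocks. -/
theorem norm_mul_sum_le_of_orthogonal {T : E →L[ℂ] E} (s : Finset ℕ)
    (hT : ∀ k ∈ s, T * P k = P k * T) {ε : ℝ} (hε : 0 ≤ ε) (h : ∀ k ∈ s, ‖T * P k‖ ≤ ε) :
    ‖T * ∑ k ∈ s, P k‖ ≤ ε := by
  refine opNorm_le_bound _ hε fun x => ?_
  have hcomm : T * ∑ k ∈ s, P k = (∑ k ∈ s, P k) * T := by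
    rw [Finset.mul_sum, Finset.sum_mul]
    exact Finset.sum_congr rfl hT
  have hQ : ‖(∑ k ∈ s, P k) x‖ ≤ ‖x‖ := by
    simpa using le_of_opNorm_le _
      (isStarProjection_sum_of_orthogonal hmul hadj s).norm_le x
  refine le_trans (abs_le_of_sq_le_sq' ?_ (by positivity)).2
    (mul_le_mul_of_nonneg_left hQ hε)
  rw [mul_pow, norm_sq_sum_apply_of_orthogonal hmul hadj, hcomm, mul_apply_eq_comp,
    norm_sq_sum_apply_of_orthogonal hmul hadj, Finset.mul_sum]
  refine Finset.sum_le_sum fun k hk => ?_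
  have h1 : P k (T x) = (T * P k) (P k x) := by
    have h2 : P k (P k x) = P k x := by
      simpa using DFunLike.congr_fun (hmul k k) x
    rw [mul_apply_eq_comp, h2]
    exact (DFunLike.congr_fun (hT k hk) x).symm
  rw [h1, ← mul_pow]
  exact pow_le_pow_left₀ (norm_nonneg _) (le_of_opNorm_le _ (h k hk) _) 2

include hmul hadj in
/-- An eventually block diagonal operator whose blocks tend to zero in norm is compact. -/
theorem isCompactOperator_of_tendsto_blocks (hcpt : ∀ k, IsCompactOperator (P k))
    (hone : ∀ x, Tendsto (fun n => (∑ k ∈ Finset.range n, P k) x) atTop (𝓝 x))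
    {T : E →L[ℂ] E} {N : ℕ} (hT : ∀ k ≥ N, T * P k = P k * T)
    (h : Tendsto (fun k => ‖T * P k‖) atTop (𝓝 0)) : IsCompactOperator T := by
  refine isCompactOperator_of_tendsto (l := atTop) (F := fun n => T * ∑ k ∈ Finset.range n, P k)
    ?_ (Eventually.of_forall fun n => ?_)
  · refine tendsto_of_tendsto_pointwise_of_cauchySeq ?_ ?_
    · rw [tendsto_pi_nhds]
      exact fun x => (T.continuous.tendsto x).comp (hone x)
    · rw [Metric.cauchySeq_iff']
      intro ε hε
      obtain ⟨M, hM⟩ := eventually_atTop.1 (h.eventually_lt_const (half_pos hε))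
      refine ⟨max M N, fun n hn => ?_⟩
      rw [dist_eq_norm, ← mul_sub, ← Finset.sum_Ico_eq_sub _ hn]
      refine lt_of_le_of_lt (norm_mul_sum_le_of_orthogonal hmul hadj _ ?_ (half_pos hε).le ?_)
        (half_lt_self hε)
      · intro k hk
        exact hT k ((le_max_right _ _).trans (Finset.mem_Ico.1 hk).1)
      · intro k hk
        exact (hM k ((le_max_left _ _).trans (Finset.mem_Ico.1 hk).1)).le
  · have hsum : ∀ s : Finset ℕ, IsCompactOperator ⇑(∑ k ∈ s, P k) := by
      intro s
      induction s using Finset.cons_induction with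
      | empty => exact isCompactOperator_zero
      | cons k s hk ih =>
        rw [Finset.sum_cons]
        exact (hcpt k).add ih
    exact (hsum _).clm_comp T

end Operators

section Fock

variable {d : ℕ}

theorem dense_span_fockBasis :
    Dense (Submodule.span ℂ (Set.range (fockBasis d)) : Set (FockSpace d)) := by
  intro x
  refine mem_closure_of_tendsto (lp.hasSum_single (by simp) x)
    (Eventually.of_forall fun s => Submodule.sum_mem _ fun α _ => ?_)
  have : lp.single 2 α (x α) = x α • fockBasis d α := by
    rw [fockBasis, ← lp.single_smul, smul_eq_mul, mul_one]
  rw [this]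
  exact Submodule.smul_mem _ _ (Submodule.subset_span ⟨α, rfl⟩)

theorem ext_fockBasis {A B : FockSpace d →L[ℂ] FockSpace d}
    (h : ∀ α, A (fockBasis d α) = B (fockBasis d α)) : A = B :=
  ext_on dense_span_fockBasis (by rintro _ ⟨α, rfl⟩; exact h α)

theorem inner_fockBasis (α β : FreeMonoid (Fin d)) :
    inner ℂ (fockBasis d α) (fockBasis d β) = if α = β then (1 : ℂ) else 0 := by
  rw [fockBasis, lp.inner_single_left, fockBasis, lp.single_apply, Pi.single_apply]
  split_ifs <;> simp

theorem ext_inner_fockBasis {A B : FockSpace d →L[ℂ] FockSpace d}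
    (h : ∀ α β, inner ℂ (fockBasis d α) (A (fockBasis d β)) =
      inner ℂ (fockBasis d α) (B (fockBasis d β))) : A = B := by
  refine ext_fockBasis fun β => ?_
  have : innerSL ℂ (A (fockBasis d β)) = innerSL ℂ (B (fockBasis d β)) := by
    refine ext_on dense_span_fockBasis ?_
    rintro _ ⟨α, rfl⟩
    have := congrArg (starRingEnd ℂ) (h α β)
    simpa only [inner_conj_symm, innerSL_apply_apply] using this
  exact (innerSL_inj (𝕜 := ℂ)).1 this

theorem FreeMonoid.exists_ofFn {α : FreeMonoid (Fin d)} {p : ℕ} (h : α.length = p) :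
    ∃ f : Fin p → Fin d, FreeMonoid.ofList (List.ofFn f) = α := by
  subst h
  exact ⟨fun i => α.toList.get i, List.ofFn_get α.toList⟩

theorem FreeMonoid.ofFn_inj {p : ℕ} {f g : Fin p → Fin d} :
    FreeMonoid.ofList (List.ofFn f) = FreeMonoid.ofList (List.ofFn g) ↔ f = g := by
  rw [FreeMonoid.ofList.injective.eq_iff, List.ofFn_inj]

theorem FreeMonoid.length_ofFn {p : ℕ} (f : Fin p → Fin d) :
    (FreeMonoid.ofList (List.ofFn f)).length = p :=
  List.length_ofFn

theorem FreeMonoid.exists_mul_of_length {α : FreeMonoid (Fin d)} {k p : ℕ}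
    (h : α.length = k + p) :
    ∃ β γ : FreeMonoid (Fin d), β.length = p ∧ γ.length = k ∧ α = β * γ := by
  have h' : α.toList.length = k + p := h
  refine ⟨FreeMonoid.ofList (α.toList.take p), FreeMonoid.ofList (α.toList.drop p), ?_, ?_, ?_⟩
  · change (α.toList.take p).length = p
    simp [h']
  · change (α.toList.drop p).length = k
    simp [h']
  · exact (List.take_append_drop p α.toList).symm

theorem FreeMonoid.mul_eq_mul_iff_of_length {α β γ δ : FreeMonoid (Fin d)}
    (h : α.length = β.length) : α * γ = β * δ ↔ α = β ∧ γ = δ :=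
  ⟨fun H => List.append_inj H h, fun H => by rw [H.1, H.2]⟩

section Creation

variable {S : Fin d → (FockSpace d →L[ℂ] FockSpace d)}
  (hS : ∀ (i : Fin d) (α : FreeMonoid (Fin d)),
    S i (fockBasis d α) = fockBasis d (FreeMonoid.of i * α))

include hS in
theorem wordOp_fockBasis (α β : FreeMonoid (Fin d)) :
    wordOp S α (fockBasis d β) = fockBasis d (α * β) := by
  induction α using FreeMonoid.recOn with
  | one => rfl
  | of_mul i α ih =>
    have : wordOp S (FreeMonoid.of i * α) = S i * wordOp S α := by simp [wordOp]
    rw [this, mul_apply_eq_comp, ih, hS, mul_assoc]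

include hS in
theorem adjoint_wordOp_mul_wordOp {α β : FreeMonoid (Fin d)} (h : α.length = β.length) :
    adjoint (wordOp S α) * wordOp S β = if α = β then 1 else 0 := by
  refine ext_inner_fockBasis fun γ δ => ?_
  rw [mul_apply_eq_comp, adjoint_inner_right, wordOp_fockBasis hS, wordOp_fockBasis hS,
    inner_fockBasis]
  simp only [FreeMonoid.mul_eq_mul_iff_of_length h]
  by_cases hαβ : α = β <;> simp [hαβ, inner_fockBasis]

end Creation

section Grading

variable {P : ℕ → (FockSpace d →L[ℂ] FockSpace d)}
  (hP : ∀ (k : ℕ) (α : FreeMonoid (Fin d)),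
    P k (fockBasis d α) = if α.length = k then fockBasis d α else 0)

include hP

theorem adjoint_lengthProj (k : ℕ) : adjoint (P k) = P k := by
  refine ext_inner_fockBasis fun α β => ?_
  rw [adjoint_inner_right, hP, hP]
  by_cases h : α = β
  · subst h
    split_ifs <;> simp
  · split_ifs <;> simp [inner_fockBasis, h]

theorem lengthProj_mul (j k : ℕ) : P j * P k = if j = k then P k else 0 := by
  refine ext_fockBasis fun α => ?_
  rw [mul_apply_eq_comp, hP]
  by_cases hα : α.length = k
  · by_cases hjk : j = k
    · simp [hα, hjk, hP]
    · simp [hα, hjk, hP, Ne.symm hjk]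
  · split_ifs <;> simp [hα, hP]

theorem isCompactOperator_lengthProj (k : ℕ) : IsCompactOperator (P k) := by
  have hsum : P k = ∑ f : Fin k → Fin d,
      InnerProductSpace.rankOne ℂ (fockBasis d (FreeMonoid.ofList (List.ofFn f)))
        (fockBasis d (FreeMonoid.ofList (List.ofFn f))) := by
    refine ext_fockBasis fun α => ?_
    simp only [_root_.sum_apply, InnerProductSpace.rankOne_apply, inner_fockBasis, hP]
    split_ifs with h
    · obtain ⟨g, rfl⟩ := FreeMonoid.exists_ofFn h
      simp
    · refine (Finset.sum_eq_zero fun f _ => ?_).symm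
      rw [if_neg, zero_smul]
      rintro rfl
      exact h (FreeMonoid.length_ofFn f)
  rw [hsum]
  refine Submodule.sum_mem
    (compactOperator (RingHom.id ℂ) (FockSpace d) (FockSpace d)) fun f _ => ?_
  exact (isCompactOperator_of_locallyCompactSpace_rng
    (toSpanSingleton ℂ (fockBasis d (FreeMonoid.ofList (List.ofFn f))))).comp_clm
    (innerSL ℂ (fockBasis d (FreeMonoid.ofList (List.ofFn f))))

theorem norm_lengthProj_le (k : ℕ) : ‖P k‖ ≤ 1 := by
  simpa using (isStarProjection_sum_of_orthogonal (lengthProj_mul hP) (adjoint_lengthProj hP)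
    {k}).norm_le

theorem tendsto_lengthProj_apply (x : FockSpace d) : Tendsto (fun k => P k x) atTop (𝓝 0) := by
  refine tendsto_apply_zero_of_dense_span (norm_lengthProj_le hP) dense_span_fockBasis ?_ x
  rintro _ ⟨α, rfl⟩
  refine tendsto_const_nhds.congr' ?_
  filter_upwards [eventually_gt_atTop α.length] with k hk
  rw [hP, if_neg hk.ne]

theorem tendsto_sum_lengthProj_apply (x : FockSpace d) :
    Tendsto (fun n => (∑ k ∈ Finset.range n, P k) x) atTop (𝓝 x) := by
  have key : Tendsto (fun n => ((∑ k ∈ Finset.range n, P k) - 1) x) atTop (𝓝 0) := by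
    refine tendsto_apply_zero_of_dense_span (C := 1 + 1) (fun n => ?_) dense_span_fockBasis ?_ x
    · refine (norm_sub_le _ _).trans <| add_le_add ?_ norm_id_le
      exact (isStarProjection_sum_of_orthogonal (lengthProj_mul hP) (adjoint_lengthProj hP)
        _).norm_le
    · rintro _ ⟨α, rfl⟩
      refine tendsto_const_nhds.congr' ?_
      filter_upwards [eventually_gt_atTop α.length] with n hn
      simp [_root_.sum_apply, hP, hn]
  simpa using key.add_const x

variable {S : Fin d → (FockSpace d →L[ℂ] FockSpace d)}
  (hS : ∀ (i : Fin d) (α : FreeMonoid (Fin d)),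
    S i (fockBasis d α) = fockBasis d (FreeMonoid.of i * α))

include hS

theorem lengthProj_mul_wordOp {α : FreeMonoid (Fin d)} {p : ℕ} (hα : α.length = p) (k : ℕ) :
    P (k + p) * wordOp S α = wordOp S α * P k := by
  refine ext_fockBasis fun β => ?_
  rw [mul_apply_eq_comp, mul_apply_eq_comp, wordOp_fockBasis hS, hP, hP, FreeMonoid.length_mul, hα]
  by_cases h : β.length = k
  · rw [if_pos (by omega), if_pos h, wordOp_fockBasis hS]
  · rw [if_neg (by omega), if_neg h, map_zero]

theorem adjoint_wordOp_mul_lengthProj {α : FreeMonoid (Fin d)} {p : ℕ} (hα : α.length = p)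
    (k : ℕ) : adjoint (wordOp S α) * P (k + p) = P k * adjoint (wordOp S α) := by
  have := congrArg star (lengthProj_mul_wordOp hP hS hα k)
  simpa only [star_mul, star_eq_adjoint, adjoint_lengthProj hP] using this

theorem sum_wordOp_mul_adjoint_mul_lengthProj (p k : ℕ) :
    (∑ f : Fin p → Fin d, wordOp S (FreeMonoid.ofList (List.ofFn f)) *
      adjoint (wordOp S (FreeMonoid.ofList (List.ofFn f)))) * P (k + p) = P (k + p) := by
  refine ext_fockBasis fun α => ?_
  rw [mul_apply_eq_comp, hP]
  split_ifs with h
  · obtain ⟨β, γ, hβ, -, rfl⟩ := FreeMonoid.exists_mul_of_length h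
    obtain ⟨g, rfl⟩ := FreeMonoid.exists_ofFn hβ
    rw [_root_.sum_apply, Finset.sum_eq_single_of_mem g (Finset.mem_univ _)]
    · rw [← wordOp_fockBasis hS, ← mul_apply_eq_comp, mul_assoc,
        adjoint_wordOp_mul_wordOp hS rfl, if_pos rfl, mul_one]
    · intro f _ hf
      rw [← wordOp_fockBasis hS, ← mul_apply_eq_comp, mul_assoc,
        adjoint_wordOp_mul_wordOp hS (hβ.symm ▸ FreeMonoid.length_ofFn f),
        if_neg (mt FreeMonoid.ofFn_inj.1 hf), mul_zero, zero_apply]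
  · simp

end Grading

section Defect

/-- The defect `∑_{|α| = p} S_α Z S_α* - Z`. -/
noncomputable def shiftDefect (S : Fin d → (FockSpace d →L[ℂ] FockSpace d))
    (Z : FockSpace d →L[ℂ] FockSpace d) (p : ℕ) : FockSpace d →L[ℂ] FockSpace d :=
  (∑ f : Fin p → Fin d, wordOp S (FreeMonoid.ofList (List.ofFn f)) * Z *
    adjoint (wordOp S (FreeMonoid.ofList (List.ofFn f)))) - Z

variable {S : Fin d → (FockSpace d →L[ℂ] FockSpace d)}
  (hS : ∀ (i : Fin d) (α : FreeMonoid (Fin d)),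
    S i (fockBasis d α) = fockBasis d (FreeMonoid.of i * α))
  {Z : FockSpace d →L[ℂ] FockSpace d} {p : ℕ}

include hS

theorem shiftDefect_mul_wordOp {α : FreeMonoid (Fin d)} (hα : α.length = p) :
    shiftDefect S Z p * wordOp S α = wordOp S α * Z - Z * wordOp S α := by
  obtain ⟨g, rfl⟩ := FreeMonoid.exists_ofFn hα
  rw [shiftDefect, sub_mul, Finset.sum_mul, Finset.sum_eq_single_of_mem g (Finset.mem_univ _)]
  · rw [mul_assoc, adjoint_wordOp_mul_wordOp hS rfl, if_pos rfl, mul_one]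
  · intro f _ hf
    rw [mul_assoc, adjoint_wordOp_mul_wordOp hS (hα.symm ▸ FreeMonoid.length_ofFn f),
      if_neg (mt FreeMonoid.ofFn_inj.1 hf), mul_zero]

theorem adjoint_wordOp_mul_shiftDefect {α : FreeMonoid (Fin d)} (hα : α.length = p) :
    adjoint (wordOp S α) * shiftDefect S Z p =
      Z * adjoint (wordOp S α) - adjoint (wordOp S α) * Z := by
  obtain ⟨g, rfl⟩ := FreeMonoid.exists_ofFn hα
  rw [shiftDefect, mul_sub, Finset.mul_sum, Finset.sum_eq_single_of_mem g (Finset.mem_univ _)]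
  · rw [← mul_assoc, ← mul_assoc, adjoint_wordOp_mul_wordOp hS rfl, if_pos rfl, one_mul]
  · intro f _ hf
    rw [← mul_assoc, ← mul_assoc,
      adjoint_wordOp_mul_wordOp hS (hα.trans (FreeMonoid.length_ofFn f).symm),
      if_neg (mt FreeMonoid.ofFn_inj.1 hf.symm), zero_mul, zero_mul]

variable {P : ℕ → (FockSpace d →L[ℂ] FockSpace d)}
  (hP : ∀ (k : ℕ) (α : FreeMonoid (Fin d)),
    P k (fockBasis d α) = if α.length = k then fockBasis d α else 0)
  (hZP : ∀ k : ℕ, Z * P k = P k * Z)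

include hP hZP

theorem shiftDefect_mul_lengthProj (k : ℕ) :
    shiftDefect S Z p * P (k + p) = P (k + p) * shiftDefect S Z p := by
  rw [shiftDefect, sub_mul, mul_sub, hZP, Finset.sum_mul, Finset.mul_sum]
  congr 1
  refine Finset.sum_congr rfl fun f _ => ?_
  have hf := FreeMonoid.length_ofFn f
  rw [mul_assoc, adjoint_wordOp_mul_lengthProj hP hS hf, ← mul_assoc, mul_assoc _ Z, hZP,
    ← mul_assoc, ← mul_assoc, ← mul_assoc, lengthProj_mul_wordOp hP hS hf]

theorem isCompactOperator_shiftDefect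
    (h : Tendsto (fun k => ‖shiftDefect S Z p * P (k + p)‖) atTop (𝓝 0)) :
    IsCompactOperator (shiftDefect S Z p) := by
  refine isCompactOperator_of_tendsto_blocks (lengthProj_mul hP) (adjoint_lengthProj hP)
    (isCompactOperator_lengthProj hP) (tendsto_sum_lengthProj_apply hP) (N := p) ?_
    ((tendsto_add_atTop_iff_nat (f := fun k => ‖shiftDefect S Z p * P k‖) p).1 h)
  intro k hk
  obtain ⟨j, rfl⟩ := Nat.exists_eq_add_of_le' hk
  exact shiftDefect_mul_lengthProj hS hP hZP j

theorem tendsto_norm_shiftDefect_mul_lengthProj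
    (h : ∀ α : FreeMonoid (Fin d), α.length = p →
      IsCompactOperator ⇑(wordOp S α * Z - Z * wordOp S α)) :
    Tendsto (fun k => ‖shiftDefect S Z p * P (k + p)‖) atTop (𝓝 0) := by
  have hbound : ∀ k, ‖shiftDefect S Z p * P (k + p)‖ ≤ ∑ f : Fin p → Fin d,
      ‖P (k + p) * (shiftDefect S Z p * wordOp S (FreeMonoid.ofList (List.ofFn f)))‖ *
        ‖adjoint (wordOp S (FreeMonoid.ofList (List.ofFn f)))‖ := by
    intro k
    have heq : shiftDefect S Z p * P (k + p) = ∑ f : Fin p → Fin d,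
        P (k + p) * (shiftDefect S Z p * wordOp S (FreeMonoid.ofList (List.ofFn f))) *
          adjoint (wordOp S (FreeMonoid.ofList (List.ofFn f))) := by
      conv_lhs => rw [← sum_wordOp_mul_adjoint_mul_lengthProj hP hS p k, Finset.sum_mul,
        Finset.mul_sum]
      refine Finset.sum_congr rfl fun f _ => ?_
      have hf := FreeMonoid.length_ofFn f
      rw [← mul_assoc (P (k + p)), ← shiftDefect_mul_lengthProj hS hP hZP,
        mul_assoc (shiftDefect S Z p) (P (k + p)), lengthProj_mul_wordOp hP hS hf, mul_assoc,
        mul_assoc, mul_assoc, adjoint_wordOp_mul_lengthProj hP hS hf]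
    rw [heq]
    exact (norm_sum_le _ _).trans (Finset.sum_le_sum fun f _ => norm_mul_le _ _)
  refine squeeze_zero (fun _ => norm_nonneg _) hbound ?_
  rw [← Finset.sum_const_zero (s := (Finset.univ : Finset (Fin p → Fin d)))]
  refine tendsto_finsetSum _ fun f _ => ?_
  have hf := FreeMonoid.length_ofFn f
  have hK : IsCompactOperator
      (shiftDefect S Z p * wordOp S (FreeMonoid.ofList (List.ofFn f))) := by
    rw [shiftDefect_mul_wordOp hS hf]
    exact h _ hf
  have := hK.tendsto_norm_mul_zero (norm_lengthProj_le hP) (tendsto_lengthProj_apply hP)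
  simpa using ((tendsto_add_atTop_iff_nat p).2 this).mul_const
    ‖adjoint (wordOp S (FreeMonoid.ofList (List.ofFn f)))‖

end Defect

end Fock

open ContinuousLinearMap in
theorem statement6 (d : ℕ) (hd : 1 ≤ d)
    (S : Fin d → (FockSpace d →L[ℂ] FockSpace d))
    (hS : ∀ (i : Fin d) (α : FreeMonoid (Fin d)),
      S i (fockBasis d α) = fockBasis d (FreeMonoid.of i * α))
    (P : ℕ → (FockSpace d →L[ℂ] FockSpace d))
    (hP : ∀ (k : ℕ) (α : FreeMonoid (Fin d)),
      P k (fockBasis d α) = if α.length = k then fockBasis d α else 0)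
    (Z : FockSpace d →L[ℂ] FockSpace d)
    (hZinv : IsUnit Z)
    (hZP : ∀ k : ℕ, Z * P k = P k * Z)
    (hZ0 : Z * P 0 = P 0)
    (p : ℕ) (hp : 1 ≤ p) :
    (Filter.Tendsto
        (fun k : ℕ =>
          ‖((∑ f : Fin p → Fin d,
              wordOp S (FreeMonoid.ofList (List.ofFn f)) * Z *
                adjoint (wordOp S (FreeMonoid.ofList (List.ofFn f)))) - Z) * P (k + p)‖)
        Filter.atTop (nhds 0) ↔
      (∀ α : FreeMonoid (Fin d), α.length = p →
        IsCompactOperator ⇑(wordOp S α * Z - Z * wordOp S α))) ∧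
    (Filter.Tendsto
        (fun k : ℕ =>
          ‖((∑ f : Fin p → Fin d,
              wordOp S (FreeMonoid.ofList (List.ofFn f)) * Z *
                adjoint (wordOp S (FreeMonoid.ofList (List.ofFn f)))) - Z) * P (k + p)‖)
        Filter.atTop (nhds 0) →
      (∀ α : FreeMonoid (Fin d), α.length = p →
        IsCompactOperator ⇑(adjoint (wordOp S α) * Z - Z * adjoint (wordOp S α)))) := by
  refine ⟨⟨fun h α hα => ?_, tendsto_norm_shiftDefect_mul_lengthProj hS hP hZP⟩, fun h α hα => ?_⟩
  · rw [← shiftDefect_mul_wordOp hS hα]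
    exact (isCompactOperator_shiftDefect hS hP hZP h).comp_clm (wordOp S α)
  · rw [← neg_sub, ← adjoint_wordOp_mul_shiftDefect hS hα]
    exact ((isCompactOperator_shiftDefect hS hP hZP h).clm_comp (adjoint (wordOp S α))).neg
end
end
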